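/- Let X_{0:n−1} be drawn from an ergodic time-homogeneous Markov chain on the finite state space E = {1, …, K} with transition matrix P whose Dobrushin coefficient satisfies r < 1, started from an arbitrary initial distribution ϱ, and let π denote the stationary distribution. Let π̂_i(X_{0:n−1}) = (1/n)Σ_{k=0}^{n−1} 1(X_k = i), fix p ≥ 1, and let τ_p = sup over y in the range of π̂ with y ≠ π of ‖y − π‖_p / ‖y − π‖₂. Then for every ε > 0 and every ε' ∈ (0,1]: P_ϱ(‖π̂(X_{0:n−1}) − π‖_p ≥ ε) ≤ ‖ϱ/π‖_{2,π} · (1 + 2/ε')^{K/2} · exp(−n ε² (1−ε')² (1−r)² / (2τ_p²)). -/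

import Mathlib

open Finset
open scoped ENNReal Classical BigOperators

/-- Probability mass of a trajectory `x : Fin n → Fin K` under the Markov chain with
initial distribution `ρ` and transition matrix `Pm`:
`ρ (x 0) * ∏_{k=0}^{n-2} Pm (x k) (x (k+1))`. -/
noncomputable def chainMass {K n : ℕ} (ρ : Fin K → ℝ) (Pm : Fin K → Fin K → ℝ)
    (x : Fin n → Fin K) : ℝ :=
  (if h : 0 < n then ρ (x ⟨0, h⟩) else 1) *
    ∏ k : Fin (n - 1),
      Pm (x ⟨k.1, by have := k.2; omega⟩) (x ⟨k.1 + 1, by have := k.2; omega⟩)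

/-- Probability of a set of trajectories under the Markov chain `(Pm, ρ)`. -/
noncomputable def chainProb {K n : ℕ} (ρ : Fin K → ℝ) (Pm : Fin K → Fin K → ℝ)
    (s : Set (Fin n → Fin K)) : ℝ :=
  ∑ x : Fin n → Fin K, if x ∈ s then chainMass ρ Pm x else 0

/-- Expectation of `g` under the Markov chain `(Pm, ρ)`. -/
noncomputable def chainExp {K n : ℕ} (ρ : Fin K → ℝ) (Pm : Fin K → Fin K → ℝ)
    (g : (Fin n → Fin K) → ℝ) : ℝ :=
  ∑ x : Fin n → Fin K, chainMass ρ Pm x * g x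

/-- The nonstationarity index `‖ϱ/π‖_{2,π} = (∑_i ϱ(i)²/π(i))^{1/2}`. -/
noncomputable def nsIndex {K : ℕ} (ϱ π : Fin K → ℝ) : ℝ :=
  Real.sqrt (∑ i, ϱ i ^ 2 / π i)

/-- The empirical measure `π̂_i(x) = (1/n) ∑_{k} 1(x_k = i)`. -/
noncomputable def empMeas {K n : ℕ} (x : Fin n → Fin K) : Fin K → ℝ :=
  fun i => (∑ k : Fin n, if x k = i then (1 : ℝ) else 0) / n

/-- The `ℓ_p` norm on `ℝ^K` (for a real exponent `p ≥ 1`). -/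
noncomputable def lpNorm {K : ℕ} (p : ℝ) (y : Fin K → ℝ) : ℝ :=
  (∑ i, |y i| ^ p) ^ (1 / p)

/-- The Dobrushin (contraction) coefficient `max_{i,j} (1/2) ∑_k |P_{ik} - P_{jk}|`. -/
noncomputable def dobrushin {K : ℕ} (Pm : Fin K → Fin K → ℝ) : ℝ :=
  ⨆ i, ⨆ j, (1 / 2) * ∑ l, |Pm i l - Pm j l|

section Net

variable {E : Type*} [NormedAddCommGroup E] [NormedSpace ℝ E] [FiniteDimensional ℝ E]

theorem card_le_of_separated_closedBall {δ : ℝ} (hδ : 0 < δ) (s : Finset E)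
    (hs : ∀ c ∈ s, ‖c‖ ≤ 1) (h : ∀ c ∈ s, ∀ d ∈ s, c ≠ d → δ ≤ ‖c - d‖) :
    (s.card : ℝ) ≤ (1 + 2 / δ) ^ Module.finrank ℝ E := by
  borelize E
  let μ : MeasureTheory.Measure E := MeasureTheory.Measure.addHaar
  have hδ2 : 0 < δ / 2 := by positivity
  have hR : 0 < 1 + δ / 2 := by positivity
  have hdisj : Set.Pairwise (s : Set E) (Function.onFun Disjoint fun c => Metric.ball c (δ / 2)) := by
    intro c hc d hd hcd
    apply Metric.ball_disjoint_ball
    rw [dist_eq_norm]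
    linarith [h c hc d hd hcd]
  have hsub : (⋃ c ∈ s, Metric.ball c (δ / 2)) ⊆ Metric.ball (0 : E) (1 + δ / 2) := by
    refine Set.iUnion₂_subset fun x hx => Metric.ball_subset_ball' ?_
    rw [dist_zero_right]
    linarith [hs x hx]
  have hvol : (s.card : ℝ≥0∞) * ENNReal.ofReal ((δ / 2) ^ Module.finrank ℝ E) *
      μ (Metric.ball 0 1) ≤
      ENNReal.ofReal ((1 + δ / 2) ^ Module.finrank ℝ E) * μ (Metric.ball 0 1) :=
    calc
      _ = μ (⋃ c ∈ s, Metric.ball c (δ / 2)) := by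
        rw [MeasureTheory.measure_biUnion_finset hdisj fun c _ => measurableSet_ball]
        simp only [μ.addHaar_ball_of_pos _ hδ2, Finset.sum_const, nsmul_eq_mul, mul_assoc]
      _ ≤ μ (Metric.ball (0 : E) (1 + δ / 2)) := MeasureTheory.measure_mono hsub
      _ = _ := by simp only [μ.addHaar_ball_of_pos _ hR]
  have hcard := ENNReal.toReal_le_of_le_ofReal (by positivity)
    ((ENNReal.mul_le_mul_iff_left (Metric.measure_ball_pos _ _ zero_lt_one).ne'
      MeasureTheory.measure_ball_lt_top.ne).1 hvol)
  rw [ENNReal.toReal_mul, ENNReal.toReal_natCast, ENNReal.toReal_ofReal (by positivity)] at hcard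
  rw [← le_div_iff₀ (by positivity), ← div_pow] at hcard
  have hbase : 1 + 2 / δ = (1 + δ / 2) / (δ / 2) := by
    field_simp
    ring
  rwa [hbase]

theorem exists_finset_net_closedBall {δ : ℝ} (hδ : 0 < δ) :
    ∃ s : Finset E, (s.card : ℝ) ≤ (1 + 2 / δ) ^ Module.finrank ℝ E ∧ (∀ c ∈ s, ‖c‖ ≤ 1) ∧
      ∀ v : E, ‖v‖ ≤ 1 → ∃ c ∈ s, ‖v - c‖ ≤ δ := by
  let T : Set ℕ := {m | ∃ s : Finset E, s.card = m ∧ (∀ c ∈ s, ‖c‖ ≤ 1) ∧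
    ∀ c ∈ s, ∀ d ∈ s, c ≠ d → δ ≤ ‖c - d‖}
  have hTne : T.Nonempty := ⟨0, ∅, by simp⟩
  have hTb : BddAbove T := by
    refine ⟨⌊(1 + 2 / δ) ^ Module.finrank ℝ E⌋₊, ?_⟩
    rintro _ ⟨s, rfl, h1, h2⟩
    exact Nat.le_floor (card_le_of_separated_closedBall hδ s h1 h2)
  obtain ⟨s, hcard, h1, h2⟩ := Nat.sSup_mem hTne hTb
  refine ⟨s, card_le_of_separated_closedBall hδ s h1 h2, h1, fun v hv => ?_⟩
  by_contra! hfar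
  have hvs : v ∉ s := fun hv' => by
    have := hfar v hv'
    simp at this
    linarith
  have hmem : s.card + 1 ∈ T := by
    refine ⟨insert v s, Finset.card_insert_of_notMem hvs, ?_, ?_⟩
    · intro c hc
      rcases Finset.mem_insert.1 hc with rfl | hc
      exacts [hv, h1 c hc]
    · intro c hc d hd hcd
      rcases Finset.mem_insert.1 hc with rfl | hc' <;>
        rcases Finset.mem_insert.1 hd with rfl | hd'
      · exact absurd rfl hcd
      · exact (hfar d hd').le
      · rw [norm_sub_rev]
        exact (hfar c hc').le
      · exact h2 c hc' d hd' hcd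
  have := le_csSup hTb hmem
  omega

end Net

/-- Hoeffding's lemma for a finitely supported distribution. -/
theorem sum_mul_exp_le_of_osc_le {ι : Type*} [Fintype ι] {w g : ι → ℝ} {c : ℝ}
    (hw : ∀ i, 0 ≤ w i) (hw1 : ∑ i, w i = 1) (hg : ∀ i j, g i - g j ≤ c) (t : ℝ) :
    ∑ i, w i * Real.exp (t * g i) ≤ Real.exp (t * ∑ i, w i * g i + c ^ 2 * t ^ 2 / 8) := by
  let _ : MeasurableSpace ι := ⊤
  have hne : Nonempty ι := by
    by_contra hempty
    rw [not_nonempty_iff] at hempty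
    simp at hw1
  let μ : MeasureTheory.Measure ι := ∑ i, ENNReal.ofReal (w i) • MeasureTheory.Measure.dirac i
  have hμ : MeasureTheory.IsProbabilityMeasure μ := by
    constructor
    simp only [μ, MeasureTheory.Measure.finsetSum_apply, MeasureTheory.Measure.smul_apply,
      MeasureTheory.measure_univ, smul_eq_mul, mul_one]
    rw [← ENNReal.ofReal_sum_of_nonneg fun i _ => hw i, hw1, ENNReal.ofReal_one]
  have hint : ∀ F : ι → ℝ, ∫ i, F i ∂μ = ∑ i, w i * F i := by
    intro F
    rw [MeasureTheory.integral_finsetSum_measure fun i _ =>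
      (MeasureTheory.integrable_dirac (by simp)).smul_measure ENNReal.ofReal_ne_top]
    refine Finset.sum_congr rfl fun i _ => ?_
    rw [MeasureTheory.integral_smul_measure, MeasureTheory.integral_dirac,
      ENNReal.toReal_ofReal (hw i), smul_eq_mul]
  obtain ⟨i₀, -, hi₀⟩ := Finset.exists_min_image Finset.univ g Finset.univ_nonempty
  have hsub := ProbabilityTheory.hasSubgaussianMGF_of_mem_Icc (X := g) (μ := μ)
    (a := g i₀) (b := g i₀ + c) (by fun_prop)
    (Filter.Eventually.of_forall fun i =>
      ⟨hi₀ i (Finset.mem_univ i), by linarith [hg i i₀]⟩)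
  have hmgf := hsub.mgf_le t
  have hconst : (((‖g i₀ + c - g i₀‖₊ / 2) ^ 2 : NNReal) : ℝ) = c ^ 2 / 4 := by
    push_cast
    rw [add_sub_cancel_left, Real.norm_eq_abs, div_pow, sq_abs]
    norm_num
  rw [hconst, ProbabilityTheory.mgf, hint, hint] at hmgf
  have hsplit : ∀ i, w i * Real.exp (t * g i) =
      (w i * Real.exp (t * (g i - ∑ j, w j * g j))) * Real.exp (t * ∑ j, w j * g j) := by
    intro i
    rw [mul_assoc, ← Real.exp_add]
    ring_nf
  rw [Finset.sum_congr rfl fun i _ => hsplit i, ← Finset.sum_mul, add_comm, Real.exp_add]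
  refine mul_le_mul_of_nonneg_right (hmgf.trans (le_of_eq ?_)) (Real.exp_pos _).le
  ring_nf

section Chain

variable {K : ℕ}

theorem half_sum_abs_sub_le_dobrushin (Pm : Fin K → Fin K → ℝ) (i j : Fin K) :
    (1 / 2) * ∑ l, |Pm i l - Pm j l| ≤ dobrushin Pm :=
  (le_ciSup (f := fun j => (1 / 2) * ∑ l, |Pm i l - Pm j l|)
    (Set.finite_range _).bddAbove j).trans
    (le_ciSup (f := fun i => ⨆ j, (1 / 2) * ∑ l, |Pm i l - Pm j l|)
      (Set.finite_range _).bddAbove i)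

theorem sum_mul_sub_sum_mul_le_dobrushin_mul {Pm : Fin K → Fin K → ℝ}
    (hrow : ∀ i, ∑ j, Pm i j = 1) {h : Fin K → ℝ} {c : ℝ} (hosc : ∀ i j, h i - h j ≤ c)
    (i j : Fin K) :
    ∑ l, Pm i l * h l - ∑ l, Pm j l * h l ≤ dobrushin Pm * c := by
  have hne : (Finset.univ : Finset (Fin K)).Nonempty := ⟨i, Finset.mem_univ i⟩
  have hc : 0 ≤ c := by simpa using hosc i i
  obtain ⟨a, -, ha⟩ := Finset.exists_min_image Finset.univ h hne
  obtain ⟨b, -, hb⟩ := Finset.exists_max_image Finset.univ h hne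
  set m := (h a + h b) / 2 with hm
  have habs : ∀ l, |h l - m| ≤ c / 2 := by
    intro l
    have h1 := ha l (Finset.mem_univ l)
    have h2 := hb l (Finset.mem_univ l)
    have h3 := hosc b a
    rw [abs_le]
    constructor <;> linarith
  have hshift : ∑ l, Pm i l * h l - ∑ l, Pm j l * h l =
      ∑ l, (Pm i l - Pm j l) * (h l - m) := by
    have : ∑ l, (Pm i l - Pm j l) * (h l - m) =
        (∑ l, Pm i l * h l - ∑ l, Pm j l * h l) - m * (∑ l, Pm i l - ∑ l, Pm j l) := by
      rw [← Finset.sum_sub_distrib, ← Finset.sum_sub_distrib, Finset.mul_sum,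
        ← Finset.sum_sub_distrib]
      exact Finset.sum_congr rfl fun l _ => by ring
    rw [this, hrow, hrow]
    ring
  rw [hshift]
  calc ∑ l, (Pm i l - Pm j l) * (h l - m) ≤ ∑ l, |Pm i l - Pm j l| * (c / 2) := by
        refine Finset.sum_le_sum fun l _ => (le_abs_self _).trans ?_
        rw [abs_mul]
        exact mul_le_mul_of_nonneg_left (habs l) (abs_nonneg _)
    _ = ((1 / 2) * ∑ l, |Pm i l - Pm j l|) * c := by
        rw [← Finset.sum_mul]
        ring
    _ ≤ dobrushin Pm * c :=
        mul_le_mul_of_nonneg_right (half_sum_abs_sub_le_dobrushin Pm i j) hc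

theorem chainMass_cons {m : ℕ} (ρ : Fin K → ℝ) (Pm : Fin K → Fin K → ℝ) (i : Fin K)
    (y : Fin m → Fin K) :
    chainMass ρ Pm (Fin.cons i y : Fin (m + 1) → Fin K) = ρ i * chainMass (Pm i) Pm y := by
  cases m with
  | zero => simp [chainMass]
  | succ m =>
    unfold chainMass
    rw [dif_pos (Nat.succ_pos _), dif_pos (Nat.succ_pos _)]
    congr 1
    change ∏ k : Fin (m + 1), _ = _
    rw [Fin.prod_univ_succ]
    rfl

theorem chainMass_nonneg {m : ℕ} {ρ : Fin K → ℝ} {Pm : Fin K → Fin K → ℝ}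
    (hρ : ∀ i, 0 ≤ ρ i) (hP : ∀ i j, 0 ≤ Pm i j) (x : Fin m → Fin K) :
    0 ≤ chainMass ρ Pm x := by
  unfold chainMass
  refine mul_nonneg ?_ (Finset.prod_nonneg fun _ _ => hP _ _)
  split_ifs
  exacts [hρ _, zero_le_one]

theorem sum_pi_succ_eq {m : ℕ} (F : (Fin (m + 1) → Fin K) → ℝ) :
    ∑ x, F x = ∑ i, ∑ y : Fin m → Fin K, F (Fin.cons i y) := by
  rw [← Fintype.sum_prod_type', ← (Fin.consEquiv fun _ => Fin K).sum_comp]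
  rfl

theorem sum_chainMass {Pm : Fin K → Fin K → ℝ} (hrow : ∀ i, ∑ j, Pm i j = 1) (m : ℕ)
    (ρ : Fin K → ℝ) : ∑ x : Fin (m + 1) → Fin K, chainMass ρ Pm x = ∑ i, ρ i := by
  induction m generalizing ρ with
  | zero =>
    rw [sum_pi_succ_eq]
    simp [chainMass]
  | succ m ih =>
    rw [sum_pi_succ_eq]
    refine Finset.sum_congr rfl fun i _ => ?_
    simp_rw [chainMass_cons]
    rw [← Finset.mul_sum, ih, hrow, mul_one]

/-- The expected value of `f (X 0) + ⋯ + f (X (m - 1))` for the chain started at a point. -/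
noncomputable def additiveMean (Pm : Fin K → Fin K → ℝ) (f : Fin K → ℝ) : ℕ → Fin K → ℝ
  | 0 => fun _ => 0
  | m + 1 => fun i => f i + ∑ j, Pm i j * additiveMean Pm f m j

theorem additiveMean_osc_le {Pm : Fin K → Fin K → ℝ} (hrow : ∀ i, ∑ j, Pm i j = 1)
    (hr : dobrushin Pm < 1) {f : Fin K → ℝ} {c : ℝ} (hf : ∀ i j, f i - f j ≤ c) (m : ℕ)
    (i j : Fin K) :
    additiveMean Pm f m i - additiveMean Pm f m j ≤ c / (1 - dobrushin Pm) := by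
  have hc : 0 ≤ c := by simpa using hf i i
  have h1r : 0 < 1 - dobrushin Pm := by linarith
  induction m generalizing i j with
  | zero => simpa [additiveMean] using div_nonneg hc h1r.le
  | succ m ih =>
    have := sum_mul_sub_sum_mul_le_dobrushin_mul hrow ih i j
    have hfix : c + dobrushin Pm * (c / (1 - dobrushin Pm)) = c / (1 - dobrushin Pm) := by
      field_simp
      ring
    simp only [additiveMean]
    linarith [hf i j]

theorem sum_stationary_mul_additiveMean {Pm : Fin K → Fin K → ℝ} {π : Fin K → ℝ}
    (hstat : ∀ j, ∑ i, π i * Pm i j = π j) (f : Fin K → ℝ) (m : ℕ) :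
    ∑ i, π i * additiveMean Pm f m i = m * ∑ i, π i * f i := by
  induction m with
  | zero => simp [additiveMean]
  | succ m ih =>
    simp only [additiveMean, mul_add, Finset.sum_add_distrib, Finset.mul_sum]
    rw [Finset.sum_comm]
    simp_rw [← mul_assoc, ← Finset.sum_mul, hstat]
    rw [ih]
    simp_rw [mul_assoc, ← Finset.mul_sum]
    push_cast
    ring

theorem chainExp_exp_le {Pm : Fin K → Fin K → ℝ} (hP : ∀ i j, 0 ≤ Pm i j)
    (hrow : ∀ i, ∑ j, Pm i j = 1) {f : Fin K → ℝ} {c : ℝ}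
    (hosc : ∀ m i j, additiveMean Pm f m i - additiveMean Pm f m j ≤ c) (t : ℝ) (m : ℕ)
    {ρ : Fin K → ℝ} (hρ : ∀ i, 0 ≤ ρ i) (hρ1 : ∑ i, ρ i = 1) :
    chainExp ρ Pm (fun x : Fin m → Fin K => Real.exp (t * ∑ k, f (x k))) ≤
      Real.exp (t * ∑ i, ρ i * additiveMean Pm f m i + m * (c ^ 2 * t ^ 2 / 8)) := by
  induction m generalizing ρ with
  | zero => simp [chainExp, chainMass, additiveMean]
  | succ m ih =>
    unfold chainExp at ih ⊢
    rw [sum_pi_succ_eq]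
    have hstep : ∀ i, ∑ y : Fin m → Fin K, chainMass ρ Pm (Fin.cons i y : Fin (m + 1) → Fin K) *
        Real.exp (t * ∑ k, f ((Fin.cons i y : Fin (m + 1) → Fin K) k)) =
        ρ i * (Real.exp (t * f i) * ∑ y : Fin m → Fin K,
          chainMass (Pm i) Pm y * Real.exp (t * ∑ k, f (y k))) := by
      intro i
      rw [Finset.mul_sum, Finset.mul_sum]
      refine Finset.sum_congr rfl fun y _ => ?_
      rw [chainMass_cons, Fin.sum_univ_succ]
      simp only [Fin.cons_zero, Fin.cons_succ]
      rw [mul_add, Real.exp_add]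
      ring
    simp_rw [hstep]
    calc _ ≤ ∑ i, ρ i * (Real.exp (t * f i) * Real.exp
          (t * ∑ j, Pm i j * additiveMean Pm f m j + m * (c ^ 2 * t ^ 2 / 8))) := by
          refine Finset.sum_le_sum fun i _ => mul_le_mul_of_nonneg_left
            (mul_le_mul_of_nonneg_left (ih (hP i) (hrow i)) (Real.exp_pos _).le) (hρ i)
      _ = (∑ i, ρ i * Real.exp (t * additiveMean Pm f (m + 1) i)) *
          Real.exp (m * (c ^ 2 * t ^ 2 / 8)) := by
          rw [Finset.sum_mul]
          refine Finset.sum_congr rfl fun i _ => ?_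
          rw [← Real.exp_add, mul_assoc, ← Real.exp_add, additiveMean]
          ring_nf
      _ ≤ Real.exp (t * ∑ i, ρ i * additiveMean Pm f (m + 1) i + c ^ 2 * t ^ 2 / 8) *
          Real.exp (m * (c ^ 2 * t ^ 2 / 8)) :=
          mul_le_mul_of_nonneg_right
            (sum_mul_exp_le_of_osc_le hρ hρ1 (hosc (m + 1)) t) (Real.exp_pos _).le
      _ = _ := by
          rw [← Real.exp_add]
          push_cast
          ring_nf

theorem chainProb_stationary_tail_le {n : ℕ} {Pm : Fin K → Fin K → ℝ}
    (hP : ∀ i j, 0 ≤ Pm i j) (hrow : ∀ i, ∑ j, Pm i j = 1) (hr : dobrushin Pm < 1)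
    {π : Fin K → ℝ} (hπ : ∀ i, 0 ≤ π i) (hπ1 : ∑ i, π i = 1)
    (hstat : ∀ j, ∑ i, π i * Pm i j = π j) {f : Fin K → ℝ} {c : ℝ} (hc : 0 < c)
    (hf : ∀ i j, f i - f j ≤ c) {a : ℝ} (ha : 0 ≤ a) :
    chainProb π Pm {x : Fin n → Fin K | n * (a + ∑ i, π i * f i) ≤ ∑ k, f (x k)} ≤
      Real.exp (-(2 * n * a ^ 2 * (1 - dobrushin Pm) ^ 2 / c ^ 2)) := by
  have h1r : 0 < 1 - dobrushin Pm := by linarith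
  set s := 1 - dobrushin Pm with hs
  set t := 4 * a * s ^ 2 / c ^ 2 with ht
  have ht0 : 0 ≤ t := by positivity
  set b := (n : ℝ) * (a + ∑ i, π i * f i) with hb
  have hexp := chainExp_exp_le hP hrow (additiveMean_osc_le hrow hr hf) t n hπ hπ1
  rw [← hs, sum_stationary_mul_additiveMean hstat] at hexp
  calc _ ≤ Real.exp (-(t * b)) *
        chainExp π Pm (fun x : Fin n → Fin K => Real.exp (t * ∑ k, f (x k))) := by
        unfold chainProb chainExp
        rw [Finset.mul_sum]
        refine Finset.sum_le_sum fun x _ => ?_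
        have hx := chainMass_nonneg hπ hP x
        split_ifs with hmem
        · have hle : t * b ≤ t * ∑ k, f (x k) := mul_le_mul_of_nonneg_left hmem ht0
          rw [mul_left_comm, ← Real.exp_add]
          exact le_mul_of_one_le_right hx (Real.one_le_exp (by linarith))
        · positivity
    _ ≤ Real.exp (-(t * b)) * _ := mul_le_mul_of_nonneg_left hexp (Real.exp_pos _).le
    _ = _ := by
        rw [← Real.exp_add]
        congr 1
        rw [hb, ht]
        field_simp
        ring

theorem chainProb_mono_of_subset_biUnion {n : ℕ} {ι : Type*} {ρ : Fin K → ℝ}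
    {Pm : Fin K → Fin K → ℝ} (hρ : ∀ i, 0 ≤ ρ i) (hP : ∀ i j, 0 ≤ Pm i j)
    {A : Set (Fin n → Fin K)} (N : Finset ι) {B : ι → Set (Fin n → Fin K)}
    (h : ∀ x ∈ A, ∃ u ∈ N, x ∈ B u) :
    chainProb ρ Pm A ≤ ∑ u ∈ N, chainProb ρ Pm (B u) := by
  unfold chainProb
  rw [Finset.sum_comm]
  refine Finset.sum_le_sum fun x _ => ?_
  have hx := chainMass_nonneg hρ hP x
  have hnn : ∀ u ∈ N, 0 ≤ if x ∈ B u then chainMass ρ Pm x else 0 := by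
    intro u _
    split_ifs
    exacts [hx, le_rfl]
  split_ifs with hmem
  · obtain ⟨u, hu, hxu⟩ := h x hmem
    refine le_trans ?_ (Finset.single_le_sum hnn hu)
    rw [if_pos hxu]
  · exact Finset.sum_nonneg hnn

/-- Change of measure to the stationary chain. -/
theorem chainProb_le_nsIndex_mul_sqrt {n : ℕ} (hn : 0 < n) {Pm : Fin K → Fin K → ℝ}
    (hP : ∀ i j, 0 ≤ Pm i j) (hrow : ∀ i, ∑ j, Pm i j = 1) {ϱ π : Fin K → ℝ}
    (hπ : ∀ i, 0 < π i) (A : Set (Fin n → Fin K)) :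
    chainProb ϱ Pm A ≤ nsIndex ϱ π * Real.sqrt (chainProb π Pm A) := by
  obtain ⟨m, rfl⟩ := Nat.exists_eq_succ_of_ne_zero hn.ne'
  have hmass : ∀ (ρ : Fin K → ℝ) (x : Fin (m + 1) → Fin K), chainMass ρ Pm x =
      ρ (x 0) / π (x 0) * chainMass π Pm x := by
    intro ρ x
    have := (hπ (x 0)).ne'
    unfold chainMass
    rw [dif_pos hn, dif_pos hn]
    change ρ (x 0) * _ = ρ (x 0) / π (x 0) * (π (x 0) * _)
    field_simp
  have hπP := fun x : Fin (m + 1) → Fin K => chainMass_nonneg (fun i => (hπ i).le) hP x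
  have hsum : nsIndex ϱ π = Real.sqrt (∑ x : Fin (m + 1) → Fin K,
      (ϱ (x 0) / π (x 0) * Real.sqrt (chainMass π Pm x)) ^ 2) := by
    rw [nsIndex, ← sum_chainMass hrow m]
    congr 1
    refine Finset.sum_congr rfl fun x _ => ?_
    have := (hπ (x 0)).ne'
    rw [hmass, mul_pow, Real.sq_sqrt (hπP x)]
    field_simp
  have hA : chainProb π Pm A = ∑ x : Fin (m + 1) → Fin K,
      (if x ∈ A then Real.sqrt (chainMass π Pm x) else 0) ^ 2 := by
    refine Finset.sum_congr rfl fun x _ => ?_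
    split_ifs
    · rw [Real.sq_sqrt (hπP x)]
    · simp
  rw [hsum, hA]
  refine le_trans (le_of_eq ?_) (Real.sum_mul_le_sqrt_mul_sqrt _ _ _)
  refine Finset.sum_congr rfl fun x _ => ?_
  split_ifs
  · rw [mul_assoc, Real.mul_self_sqrt (hπP x), ← hmass]
  · simp

theorem sum_mul_empMeas {n : ℕ} (f : Fin K → ℝ) (x : Fin n → Fin K) :
    ∑ i, f i * empMeas x i = (∑ k, f (x k)) / n := by
  simp only [empMeas, mul_div_assoc', ← Finset.sum_div, Finset.mul_sum]
  rw [Finset.sum_comm]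
  simp

theorem sub_le_sqrt_two_of_norm_le_one {u : EuclideanSpace ℝ (Fin K)} (hu : ‖u‖ ≤ 1)
    (i j : Fin K) : u i - u j ≤ Real.sqrt 2 := by
  rcases eq_or_ne i j with rfl | hij
  · simp
  apply Real.le_sqrt_of_sq_le
  have h1 : ∑ l, u l ^ 2 ≤ 1 := by
    rw [← EuclideanSpace.real_norm_sq_eq]
    nlinarith [norm_nonneg u]
  have h2 : ∑ l ∈ {i, j}, u l ^ 2 ≤ ∑ l, u l ^ 2 :=
    Finset.sum_le_sum_of_subset_of_nonneg (Finset.subset_univ _) fun _ _ _ => sq_nonneg _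
  rw [Finset.sum_pair hij] at h2
  nlinarith [sq_nonneg (u i + u j)]

theorem exists_inner_ge_of_net {N : Finset (EuclideanSpace ℝ (Fin K))} {δ : ℝ}
    (hN : ∀ v : EuclideanSpace ℝ (Fin K), ‖v‖ ≤ 1 → ∃ u ∈ N, ‖v - u‖ ≤ δ) (z : Fin K → ℝ) :
    ∃ u ∈ N, (1 - δ) * Real.sqrt (∑ i, z i ^ 2) ≤ ∑ i, u i * z i := by
  set Z : EuclideanSpace ℝ (Fin K) := WithLp.toLp 2 z with hZ
  have hnorm : ‖Z‖ = Real.sqrt (∑ i, z i ^ 2) := by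
    rw [EuclideanSpace.norm_eq]
    simp [hZ]
  have hinner : ∀ u : EuclideanSpace ℝ (Fin K), inner ℝ u Z = ∑ i, u i * z i := by
    intro u
    simp [PiLp.inner_apply, hZ, mul_comm]
  obtain ⟨u, hu, hdist⟩ := hN (‖Z‖⁻¹ • Z) (by
    rw [norm_smul, norm_inv, norm_norm]
    exact inv_mul_le_one)
  refine ⟨u, hu, ?_⟩
  rw [← hnorm, ← hinner]
  have hself : inner ℝ (‖Z‖⁻¹ • Z) Z = ‖Z‖ := by
    rw [real_inner_smul_left, real_inner_self_eq_norm_sq]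
    rcases eq_or_ne ‖Z‖ 0 with h0 | h0
    · simp [h0]
    · field_simp
  have hdiff : inner ℝ (‖Z‖⁻¹ • Z - u) Z ≤ δ * ‖Z‖ :=
    (real_inner_le_norm _ _).trans (mul_le_mul_of_nonneg_right hdist (norm_nonneg _))
  rw [inner_sub_left, hself] at hdiff
  linarith

end Chain

theorem stmt17 {K n : ℕ} (hK : 0 < K) (hn : 0 < n)
    (Pm : Fin K → Fin K → ℝ)
    (hPnn : ∀ i j, 0 ≤ Pm i j) (hProw : ∀ i, ∑ j, Pm i j = 1)
    (r : ℝ) (hrdef : r = dobrushin Pm) (hr : r < 1)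
    (ϱ : Fin K → ℝ) (hϱnn : ∀ i, 0 ≤ ϱ i) (hϱsum : ∑ i, ϱ i = 1)
    (π : Fin K → ℝ) (hπpos : ∀ i, 0 < π i) (hπsum : ∑ i, π i = 1)
    (hπstat : ∀ j, ∑ i, π i * Pm i j = π j)
    (p : ℝ) (hp : 1 ≤ p)
    (τ : ℝ)
    (hτ : τ = sSup {t : ℝ | ∃ x : Fin n → Fin K, empMeas x ≠ π ∧
      t = lpNorm p (fun i => empMeas x i - π i) /
          Real.sqrt (∑ i, (empMeas x i - π i) ^ 2)})
    (ε : ℝ) (hε : 0 < ε) (ε' : ℝ) (hε' : ε' ∈ Set.Ioc (0 : ℝ) 1) :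
    chainProb ϱ Pm {x : Fin n → Fin K | ε ≤ lpNorm p (fun i => empMeas x i - π i)} ≤
      nsIndex ϱ π * (1 + 2 / ε') ^ ((K : ℝ) / 2) *
        Real.exp (-(n * ε ^ 2 * (1 - ε') ^ 2 * (1 - r) ^ 2) / (2 * τ ^ 2)) := by
  subst hrdef
  set A := {x : Fin n → Fin K | ε ≤ lpNorm p (fun i => empMeas x i - π i)} with hA
  have hn' : (0 : ℝ) < n := by exact_mod_cast hn
  obtain ⟨hε'0, hε'1⟩ := hε'
  have hbase : 0 < 1 + 2 / ε' := by positivity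
  have hratio : ∀ x ∈ A, 0 < τ ∧ ε / τ ≤ Real.sqrt (∑ i, (empMeas x i - π i) ^ 2) := by
    intro x hx
    have hne : empMeas x ≠ π := by
      intro heq
      have hx' : ε ≤ lpNorm p (fun i => empMeas x i - π i) := hx
      have hp0 : p ≠ 0 := by linarith
      simp [lpNorm, heq, Real.zero_rpow hp0, Real.zero_rpow (inv_ne_zero hp0)] at hx'
      linarith
    have hpos : 0 < Real.sqrt (∑ i, (empMeas x i - π i) ^ 2) := by
      obtain ⟨i, hi⟩ := Function.ne_iff.1 hne
      refine Real.sqrt_pos.2 (Finset.sum_pos' (fun _ _ => sq_nonneg _) ⟨i, Finset.mem_univ i, ?_⟩)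
      have := sub_ne_zero.2 hi
      positivity
    have hle : lpNorm p (fun i => empMeas x i - π i) /
        Real.sqrt (∑ i, (empMeas x i - π i) ^ 2) ≤ τ := by
      rw [hτ]
      refine le_csSup (Set.Finite.bddAbove ?_) ⟨x, hne, rfl⟩
      refine (Set.finite_range fun x : Fin n → Fin K =>
        lpNorm p (fun i => empMeas x i - π i) /
          Real.sqrt (∑ i, (empMeas x i - π i) ^ 2)).subset ?_
      rintro _ ⟨y, -, rfl⟩
      exact ⟨y, rfl⟩
    have hετ := (div_le_div_of_nonneg_right hx hpos.le).trans hle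
    have hτ0 : 0 < τ := (div_pos hε hpos).trans_le hετ
    exact ⟨hτ0, (div_le_comm₀ hτ0 hpos).2 hετ⟩
  refine (chainProb_le_nsIndex_mul_sqrt hn hPnn hProw hπpos A).trans ?_
  rw [mul_assoc]
  refine mul_le_mul_of_nonneg_left ?_ (Real.sqrt_nonneg _)
  rcases A.eq_empty_or_nonempty with hempty | ⟨x₀, hx₀⟩
  · rw [hempty]
    simp only [chainProb, Set.mem_empty_iff_false, if_false, Finset.sum_const_zero, Real.sqrt_zero]
    positivity
  have hτ0 := (hratio x₀ hx₀).1
  obtain ⟨N, hcard, hN1, hN⟩ :=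
    exists_finset_net_closedBall (E := EuclideanSpace ℝ (Fin K)) hε'0
  rw [finrank_euclideanSpace_fin] at hcard
  set a := (1 - ε') * (ε / τ) with ha
  have ha0 : 0 ≤ a := mul_nonneg (by linarith) (by positivity)
  have hcover : chainProb π Pm A ≤ ∑ u ∈ N, chainProb π Pm
      {x : Fin n → Fin K | n * (a + ∑ i, π i * u i) ≤ ∑ k, u (x k)} := by
    refine chainProb_mono_of_subset_biUnion (fun i => (hπpos i).le) hPnn N fun x hx => ?_
    obtain ⟨u, hu, huz⟩ := exists_inner_ge_of_net hN fun i => empMeas x i - π i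
    refine ⟨u, hu, ?_⟩
    have h1 : a ≤ ∑ i, u i * (empMeas x i - π i) :=
      (mul_le_mul_of_nonneg_left (hratio x hx).2 (by linarith)).trans huz
    simp only [mul_sub, Finset.sum_sub_distrib] at h1
    rw [sum_mul_empMeas (fun i => u i)] at h1
    have h2 : a + ∑ i, π i * u i ≤ (∑ k, u (x k)) / n := by
      simp only [mul_comm (π _)]
      linarith
    rw [Set.mem_ofPred_eq, mul_comm]
    exact (le_div_iff₀ hn').1 h2
  have hprob : chainProb π Pm A ≤
      (1 + 2 / ε') ^ K * Real.exp (-(n * a ^ 2 * (1 - dobrushin Pm) ^ 2)) := by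
    refine hcover.trans ((Finset.sum_le_card_nsmul N _ _ fun u hu =>
      chainProb_stationary_tail_le hPnn hProw hr (fun i => (hπpos i).le) hπsum hπstat
        (Real.sqrt_pos.2 two_pos) (sub_le_sqrt_two_of_norm_le_one (hN1 u hu)) ha0).trans ?_)
    rw [nsmul_eq_mul, Real.sq_sqrt zero_le_two]
    refine (mul_le_mul_of_nonneg_right hcard (Real.exp_pos _).le).trans (le_of_eq ?_)
    congr 2
    ring
  refine (Real.sqrt_le_sqrt hprob).trans (le_of_eq ?_)
  rw [Real.sqrt_mul (by positivity), Real.sqrt_eq_rpow, ← Real.rpow_natCast,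
    ← Real.rpow_mul hbase.le, ← Real.exp_half]
  congr 2
  · ring
  · rw [ha]
    field_simp
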